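/- Fix R > 1 and ε, ε' ∈ {1, −1}. Let D, L_t ∈ PSL(2,ℝ) have lifts diag(R^{1/2}, R^{−1/2}) and [[cosh(t/2), sinh(t/2)],[sinh(t/2), cosh(t/2)]] respectively, and set p_t = D⁻¹·L_t⁻¹·i and p'_t = D·L_t·i in ℍ (where i is the imaginary unit); these parametrize the geodesic lines {z ∈ ℍ : |z| = 1/R} and {z ∈ ℍ : |z| = R}. Let g, g' ∈ PSL(2,ℝ) and let [[a,b],[c,d]] ∈ SL(2,ℝ) be a lift of g⁻¹g' (so ad − bc = 1). If aR + ε'b + εc + εε'd/R ≠ 0, then d(g·p_{εs}, g'·p'_{ε't}) − d(p_{εs}, p'_{ε't}) converges to log( (aR + ε'b + εc + εε'd/R)² / (R + εε'/R)² ) as (s,t) → (+∞, +∞). -/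

import Mathlib

noncomputable section

open Filter Topology Pointwise
open scoped UpperHalfPlane

/-- `SL(2,ℝ)`. -/
abbrev SL2 := Matrix.SpecialLinearGroup (Fin 2) ℝ

instance : TopologicalSpace SL2 :=
  TopologicalSpace.induced (fun A : SL2 => (A : Matrix (Fin 2) (Fin 2) ℝ)) inferInstance

/-- `PSL(2,ℝ) = SL(2,ℝ)/{±I}`. -/
abbrev PSL2 := SL2 ⧸ Subgroup.center SL2

/-- The Möbius action of an element of `PSL(2,ℝ)` on the upper half-plane,
computed via an (arbitrary) lift to `SL(2,ℝ)`; this is well defined since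
`-I` acts trivially. -/
def pslSMul (g : PSL2) (z : ℍ) : ℍ := (Quotient.out g) • z

/-- Image of a subset of `ℍ` under the Möbius action of `g ∈ PSL(2,ℝ)`. -/
def pslImg (g : PSL2) (s : Set ℍ) : Set ℍ := pslSMul g '' s

/-- A geodesic line of `ℍ`: the image of an isometric embedding of `ℝ` into `ℍ`. -/
def IsGeodesicLine (l : Set ℍ) : Prop := ∃ γ : ℝ → ℍ, Isometry γ ∧ Set.range γ = l

/-- The embedding of `ℍ` into the one-point compactification of `ℂ`. -/
def embH (z : ℍ) : OnePoint ℂ := ((z : ℂ) : OnePoint ℂ)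

/-- The embedding of `∂∞ℍ = ℝ ∪ {∞}` into the one-point compactification of `ℂ`. -/
def toC : OnePoint ℝ → OnePoint ℂ := OnePoint.map Complex.ofReal

/-- The vector `v(ξ) ∈ ℝ²` associated with a boundary point `ξ ∈ ℝ ∪ {∞}`:
`v(ξ) = (ξ, 1)` for `ξ ∈ ℝ` and `v(∞) = (1, 0)`. -/
def bvec (ξ : OnePoint ℝ) : Fin 2 → ℝ := Option.elim ξ ![1, 0] (fun r => ![r, 1])

/-- The extended Möbius action of `PSL(2,ℝ)` on `∂∞ℍ = ℝ ∪ {∞}`. -/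
def bdSMul (g : PSL2) (ξ : OnePoint ℝ) : OnePoint ℝ :=
  let w := ((Quotient.out g : SL2) : Matrix (Fin 2) (Fin 2) ℝ).mulVec (bvec ξ)
  if w 1 = 0 then OnePoint.infty else ((w 0 / w 1 : ℝ) : OnePoint ℝ)

/-- `ξ ∈ ℝ ∪ {∞}` is an endpoint of the geodesic line `l`: some isometric
parametrization of `l` tends to `ξ` (in the one-point compactification of `ℂ`). -/
def IsEndpoint (l : Set ℍ) (ξ : OnePoint ℝ) : Prop :=
  ∃ γ : ℝ → ℍ, Isometry γ ∧ Set.range γ = l ∧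
    Tendsto (fun t => embH (γ t)) atTop (𝓝 (toC ξ))

/-- `h ∈ PSL(2,ℝ)` has a nonattracting fixed point at `ξ ∈ ℝ ∪ {∞}`. -/
def HasNonattracting (h : PSL2) (ξ : OnePoint ℝ) : Prop :=
  ∃ A : SL2, (QuotientGroup.mk A : PSL2) = h ∧
    ∃ μ : ℝ, |μ| ≤ 1 ∧ (A : Matrix (Fin 2) (Fin 2) ℝ).mulVec (bvec ξ) = μ • bvec ξ

/-- `h ∈ PSL(2,ℝ)` has a nonrepelling fixed point at `ξ ∈ ℝ ∪ {∞}`. -/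
def HasNonrepelling (h : PSL2) (ξ : OnePoint ℝ) : Prop :=
  ∃ A : SL2, (QuotientGroup.mk A : PSL2) = h ∧
    ∃ μ : ℝ, 1 ≤ |μ| ∧ (A : Matrix (Fin 2) (Fin 2) ℝ).mulVec (bvec ξ) = μ • bvec ξ

/-- The right AdS crooked plane `C*(l)` centered at the identity. -/
def rightCrooked (l : Set ℍ) : Set PSL2 :=
  {h | (∃ x ∈ l, pslSMul h x = x) ∨ ∃ ξ, IsEndpoint l ξ ∧ HasNonattracting h ξ}

/-- The left AdS crooked plane `C(l)` centered at the identity. -/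
def leftCrooked (l : Set ℍ) : Set PSL2 :=
  {h | (∃ x ∈ l, pslSMul h x = x) ∨ ∃ ξ, IsEndpoint l ξ ∧ HasNonrepelling h ξ}

/-- A general right AdS crooked plane: a set of the form `g·C*(l)`. -/
def IsRightCrookedPlane (S : Set PSL2) : Prop :=
  ∃ (g : PSL2) (l : Set ℍ), IsGeodesicLine l ∧ S = (g * ·) '' rightCrooked l

/-- A general left AdS crooked plane: a set of the form `C(l)·g`. -/
def IsLeftCrookedPlane (S : Set PSL2) : Prop :=
  ∃ (g : PSL2) (l : Set ℍ), IsGeodesicLine l ∧ S = (· * g) '' leftCrooked l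

variable {Γ : Type*} [Group Γ]

/-- The action `γ·x = ρ(γ) x j(γ)⁻¹` of `Γ` on `PSL(2,ℝ)`, applied to a set. -/
def actImg (j ρ : Γ →* PSL2) (γ : Γ) (S : Set PSL2) : Set PSL2 :=
  (fun x => ρ γ * x * (j γ)⁻¹) '' S

/-- The action `γ·x = ρ(γ) x j(γ)⁻¹` is properly discontinuous. -/
def ProperlyDisc (j ρ : Γ →* PSL2) : Prop :=
  ∀ K : Set PSL2, IsCompact K → {γ : Γ | (actImg j ρ γ K ∩ K).Nonempty}.Finite

/-- `R` is a fundamental domain for the action `γ·x = ρ(γ) x j(γ)⁻¹`: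
`R` is closed, its translates cover `PSL(2,ℝ)`, and the interiors of the
translates are pairwise disjoint. -/
def IsFundDom (j ρ : Γ →* PSL2) (R : Set PSL2) : Prop :=
  IsClosed R ∧ (⋃ γ : Γ, actImg j ρ γ R) = Set.univ ∧
    Pairwise fun γ₁ γ₂ : Γ =>
      Disjoint (interior (actImg j ρ γ₁ R)) (interior (actImg j ρ γ₂ R))

/-- The action admits a fundamental domain bounded by pairwise disjoint
right AdS crooked planes. -/
def AdmitsRightCrookedFD (j ρ : Γ →* PSL2) : Prop :=
  ∃ (m : ℕ) (D : Fin m → Set PSL2), (∀ i, IsRightCrookedPlane (D i)) ∧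
    (∀ (γ γ' : Γ) (i i' : Fin m),
      actImg j ρ γ (D i) = actImg j ρ γ' (D i') ∨
      Disjoint (actImg j ρ γ (D i)) (actImg j ρ γ' (D i'))) ∧
    ∃ x ∈ (⋃ (γ : Γ) (i : Fin m), actImg j ρ γ (D i))ᶜ,
      IsFundDom j ρ
        (closure (connectedComponentIn (⋃ (γ : Γ) (i : Fin m), actImg j ρ γ (D i))ᶜ x))

/-- The action admits a fundamental domain bounded by pairwise disjoint
left AdS crooked planes. -/
def AdmitsLeftCrookedFD (j ρ : Γ →* PSL2) : Prop :=
  ∃ (m : ℕ) (D : Fin m → Set PSL2), (∀ i, IsLeftCrookedPlane (D i)) ∧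
    (∀ (γ γ' : Γ) (i i' : Fin m),
      actImg j ρ γ (D i) = actImg j ρ γ' (D i') ∨
      Disjoint (actImg j ρ γ (D i)) (actImg j ρ γ' (D i'))) ∧
    ∃ x ∈ (⋃ (γ : Γ) (i : Fin m), actImg j ρ γ (D i))ᶜ,
      IsFundDom j ρ
        (closure (connectedComponentIn (⋃ (γ : Γ) (i : Fin m), actImg j ρ γ (D i))ᶜ x))

/-- The translation length `λ(g) = inf_{p ∈ ℍ} d(p, g·p)`. -/
def transLength (g : PSL2) : ℝ := ⨅ p : ℍ, dist p (pslSMul g p)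

/-- `U` is a connected component of `S`. -/
def IsCC (S U : Set ℍ) : Prop := ∃ x ∈ S, connectedComponentIn S x = U

/-- `ξ ∈ ℝ ∪ {∞}` is an ideal point of `U ⊆ ℍ`: a limit of a sequence of points
of `U` in the one-point compactification of `ℂ`. -/
def IsIdealPoint (U : Set ℍ) (ξ : OnePoint ℝ) : Prop :=
  ∃ u : ℕ → ℍ, (∀ n, u n ∈ U) ∧ Tendsto (fun n => embH (u n)) atTop (𝓝 (toC ξ))

/-- The closed right crooked half-space `H̄*₊(l, U)`. -/
def closedRHS (l U : Set ℍ) : Set PSL2 :=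
  {h | (∃ x ∈ l ∪ U, pslSMul h x = x) ∨ ∃ ξ, IsIdealPoint U ξ ∧ HasNonattracting h ξ}

/-- The open right crooked half-space `H*₊(l, U)`. -/
def openRHS (l U : Set ℍ) : Set PSL2 :=
  {h | h ≠ 1 ∧ ((∃ x ∈ U, pslSMul h x = x) ∨
    ∃ ξ, IsIdealPoint U ξ ∧ ¬ IsEndpoint l ξ ∧ HasNonattracting h ξ)}

/-- The circle of (Euclidean) radius `c` in `ℍ` centered at `0`; for suitable `c`
this is a geodesic line of `ℍ`. -/
def circ (c : ℝ) : Set ℍ := {z : ℍ | ‖(z : ℂ)‖ = c}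

/-- The stem quadrant `SQ(ℓ)` for `ℓ = {|z| = 1/R}` transversely oriented towards `0`. -/
def SQell (R : ℝ) : Set PSL2 :=
  {h | ∃ (A : SL2) (α β v : ℝ), (QuotientGroup.mk A : PSL2) = h ∧
    (A : Matrix (Fin 2) (Fin 2) ℝ) = !![α, -v/R; v*R, β] ∧
    |α| < |β| ∧ 2*|v| < |α - β|}

/-- The inverse stem quadrant `SQ(ℓ')⁻¹` for `ℓ' = {|z| = R}` transversely
oriented towards `∞`. -/
def SQell'inv (R : ℝ) : Set PSL2 :=
  {h | ∃ (A : SL2) (α β v : ℝ), (QuotientGroup.mk A : PSL2) = h ∧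
    (A : Matrix (Fin 2) (Fin 2) ℝ) = !![α, v*R; -v/R, β] ∧
    |α| < |β| ∧ 2*|v| < |α - β|}

/-- The stem quadrant `SQ(ℓ')`. -/
def SQell' (R : ℝ) : Set PSL2 := {h | h⁻¹ ∈ SQell'inv R}

theorem aux_center_smul (A : SL2) (hA : A ∈ Subgroup.center SL2) (z : ℍ) : A • z = z := by
  have h := Matrix.SpecialLinearGroup.scalar_eq_self_of_mem_center hA 0
  have h01 : A 0 1 = 0 := by
    have := congrFun (congrFun h 0) 1
    simpa using this.symm
  have h10 : A 1 0 = 0 := by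
    have := congrFun (congrFun h 1) 0
    simpa using this.symm
  have h11 : A 1 1 = A 0 0 := by
    have := congrFun (congrFun h 1) 1
    simpa using this.symm
  have hdet := A.det_coe
  rw [Matrix.det_fin_two, h01, h11] at hdet
  have h0 : (A 0 0 : ℝ) ≠ 0 := by
    intro h0
    rw [h0] at hdet
    simp at hdet
  have h0' : ((A 0 0 : ℝ) : ℂ) ≠ 0 := by exact_mod_cast h0
  apply UpperHalfPlane.ext
  rw [UpperHalfPlane.coe_specialLinearGroup_apply]
  simp [h01, h10, h11]
  field_simp

theorem aux_mk_smul (A : SL2) (z : ℍ) : pslSMul (QuotientGroup.mk A : PSL2) z = A • z := by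
  unfold pslSMul
  have h : (QuotientGroup.mk (Quotient.out (QuotientGroup.mk A : PSL2)) : PSL2)
      = QuotientGroup.mk A := QuotientGroup.out_eq' _
  rw [eq_comm, QuotientGroup.eq] at h
  have h2 := aux_center_smul _ h z
  rw [mul_smul, inv_smul_eq_iff] at h2
  exact h2

theorem aux_mul_smul (g h : PSL2) (z : ℍ) : pslSMul (g * h) z = pslSMul g (pslSMul h z) := by
  obtain ⟨A, rfl⟩ := QuotientGroup.mk_surjective g
  obtain ⟨B, rfl⟩ := QuotientGroup.mk_surjective h
  rw [← QuotientGroup.mk_mul, aux_mk_smul, aux_mk_smul, aux_mk_smul, mul_smul]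

theorem aux_dist (g : PSL2) (z w : ℍ) : dist (pslSMul g z) (pslSMul g w) = dist z w :=
  dist_smul _ _ _

theorem aux_one_smul (z : ℍ) : pslSMul 1 z = z := by
  have := aux_mk_smul 1 z
  rwa [one_smul] at this

theorem aux_dist' (g g' : PSL2) (z w : ℍ) :
    dist (pslSMul g z) (pslSMul g' w) = dist z (pslSMul (g⁻¹ * g') w) := by
  rw [← aux_dist g z, ← aux_mul_smul, mul_inv_cancel_left]

theorem aux_cosh (A : SL2) : 2 * Real.cosh (dist UpperHalfPlane.I (A • UpperHalfPlane.I)) =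
    A 0 0 ^ 2 + A 0 1 ^ 2 + A 1 0 ^ 2 + A 1 1 ^ 2 := by
  have hdet := A.det_coe
  rw [Matrix.det_fin_two] at hdet
  have hpos : 0 < A 1 0 ^ 2 + A 1 1 ^ 2 := by
    by_contra hcon
    have h1 : A 1 0 = 0 := by nlinarith [sq_nonneg (A 1 0), sq_nonneg (A 1 1)]
    have h2 : A 1 1 = 0 := by nlinarith [sq_nonneg (A 1 0), sq_nonneg (A 1 1)]
    rw [h1, h2] at hdet
    simp at hdet
  have hc : ((A • UpperHalfPlane.I : ℍ) : ℂ) =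
      (A 0 0 * Complex.I + A 0 1) / (A 1 0 * Complex.I + A 1 1) := by
    rw [UpperHalfPlane.coe_specialLinearGroup_apply]
    simp
  have hre : (A • UpperHalfPlane.I : ℍ).re =
      (A 0 0 * A 1 0 + A 0 1 * A 1 1) / (A 1 0 ^ 2 + A 1 1 ^ 2) := by
    rw [← UpperHalfPlane.coe_re, hc, Complex.div_re]
    simp [Complex.normSq_apply]
    rw [← add_div]
    congr 1 <;> ring
  have him : (A • UpperHalfPlane.I : ℍ).im = 1 / (A 1 0 ^ 2 + A 1 1 ^ 2) := by
    rw [← UpperHalfPlane.coe_im, hc, Complex.div_im]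
    simp [Complex.normSq_apply]
    rw [← sub_div, ← one_div]
    congr 1
    ring
  rw [UpperHalfPlane.cosh_dist', hre, him]
  simp only [UpperHalfPlane.I_re, UpperHalfPlane.I_im]
  generalize A 0 0 = a at *
  generalize A 0 1 = b at *
  generalize A 1 0 = c at *
  generalize A 1 1 = d at *
  have hne := hpos.ne'
  field_simp
  linear_combination (-(1 + (a * d - b * c))) * hdet

theorem aux_log (l : Filter (ℝ × ℝ)) (f E : ℝ × ℝ → ℝ) (K : ℝ) (hK : 0 < K)
    (hf : ∀ x, 0 ≤ f x)
    (hE : Tendsto E l atTop)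
    (hlim : Tendsto (fun x => 2 * Real.cosh (f x) * Real.exp (- E x)) l (𝓝 K)) :
    Tendsto (fun x => f x - E x) l (𝓝 (Real.log K)) := by
  have h1 : Tendsto (fun x => Real.exp (- E x)) l (𝓝 0) :=
    Real.tendsto_exp_neg_atTop_nhds_zero.comp hE
  have h2 : Tendsto (fun x => (2 * Real.cosh (f x) * Real.exp (- E x)
      + Real.sqrt ((2 * Real.cosh (f x) * Real.exp (- E x)) ^ 2 - 4 * Real.exp (- E x) ^ 2)) / 2)
      l (𝓝 ((K + Real.sqrt (K ^ 2 - 4 * 0 ^ 2)) / 2)) :=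
    (hlim.add (((hlim.pow 2).sub ((h1.pow 2).const_mul 4)).sqrt)).div_const 2
  have h3 : (K + Real.sqrt (K ^ 2 - 4 * 0 ^ 2)) / 2 = K := by
    have : K ^ 2 - 4 * 0 ^ 2 = K ^ 2 := by ring
    rw [this, Real.sqrt_sq hK.le]; ring
  rw [h3] at h2
  have h4 := h2.log hK.ne'
  refine h4.congr fun x => ?_
  have h5 : (2 * Real.cosh (f x) * Real.exp (- E x)) ^ 2 - 4 * Real.exp (- E x) ^ 2
      = (2 * Real.sinh (f x) * Real.exp (- E x)) ^ 2 := by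
    have := Real.cosh_sq (f x)
    linear_combination 4 * Real.exp (- E x) ^ 2 * this
  have h6 : 0 ≤ 2 * Real.sinh (f x) * Real.exp (- E x) := by
    have := Real.sinh_nonneg_iff.2 (hf x)
    positivity
  rw [h5, Real.sqrt_sq h6]
  have h7 : (2 * Real.cosh (f x) * Real.exp (- E x) + 2 * Real.sinh (f x) * Real.exp (- E x)) / 2
      = Real.exp (f x - E x) := by
    rw [sub_eq_add_neg, Real.exp_add, ← Real.cosh_add_sinh (f x)]; ring
  rw [h7, Real.log_exp]

theorem aux_cs (ε : ℝ) (hε : ε = 1 ∨ ε = -1) (s : ℝ) :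
    Real.cosh (ε * s / 2) = Real.exp (s / 2) * ((1 + Real.exp (-s)) / 2) ∧
    Real.sinh (ε * s / 2) = Real.exp (s / 2) * (ε * (1 - Real.exp (-s)) / 2) := by
  have h : Real.exp (s / 2) * Real.exp (-s) = Real.exp (-(s / 2)) := by
    rw [← Real.exp_add]; congr 1; ring
  rcases hε with rfl | rfl
  · rw [one_mul, Real.cosh_eq, Real.sinh_eq]
    constructor
    · linear_combination (-1 / 2 : ℝ) * h
    · linear_combination (1 / 2 : ℝ) * h
  · rw [show -1 * s / 2 = -(s / 2) by ring, Real.cosh_neg, Real.sinh_neg, Real.cosh_eq,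
      Real.sinh_eq]
    constructor
    · linear_combination (-1 / 2 : ℝ) * h
    · linear_combination (-1 / 2 : ℝ) * h

theorem aux_key (R : ℝ) (hR : 1 < R) (ε ε' : ℝ)
    (hε : ε = 1 ∨ ε = -1) (hε' : ε' = 1 ∨ ε' = -1)
    (D : PSL2)
    (hD : ∃ A : SL2, (QuotientGroup.mk A : PSL2) = D ∧
      (A : Matrix (Fin 2) (Fin 2) ℝ) = !![Real.sqrt R, 0; 0, (Real.sqrt R)⁻¹])
    (L : ℝ → PSL2)
    (hL : ∀ t : ℝ, ∃ A : SL2, (QuotientGroup.mk A : PSL2) = L t ∧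
      (A : Matrix (Fin 2) (Fin 2) ℝ) =
        !![Real.cosh (t / 2), Real.sinh (t / 2); Real.sinh (t / 2), Real.cosh (t / 2)])
    (h : PSL2) (a b c d : ℝ)
    (hlift : ∃ A : SL2, (QuotientGroup.mk A : PSL2) = h ∧
      (A : Matrix (Fin 2) (Fin 2) ℝ) = !![a, b; c, d])
    (hne : a * R + ε' * b + ε * c + ε * ε' * d / R ≠ 0) :
    Tendsto
      (fun st : ℝ × ℝ =>
        dist (pslSMul (D⁻¹ * (L (ε * st.1))⁻¹) UpperHalfPlane.I)
          (pslSMul h (pslSMul (D * L (ε' * st.2)) UpperHalfPlane.I)) - (st.1 + st.2))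
      (atTop ×ˢ atTop)
      (𝓝 (Real.log ((a * R + ε' * b + ε * c + ε * ε' * d / R) ^ 2 / 4))) := by
  apply aux_log
  · positivity
  · intro x; exact dist_nonneg
  · exact tendsto_fst.atTop_add_atTop tendsto_snd
  obtain ⟨AD, rfl, hAD⟩ := hD
  obtain ⟨A, rfl, hA⟩ := hlift
  choose AL hAL1 hAL2 using hL
  have hd : ∀ s t : ℝ, dist (pslSMul ((QuotientGroup.mk AD)⁻¹ * (L s)⁻¹) UpperHalfPlane.I)
      (pslSMul (QuotientGroup.mk A) (pslSMul (QuotientGroup.mk AD * L t) UpperHalfPlane.I))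
      = dist UpperHalfPlane.I ((AL s * (AD * (A * (AD * AL t)))) • UpperHalfPlane.I) := by
    intro s t
    rw [← aux_mk_smul, ← aux_mul_smul, ← aux_dist (L s * QuotientGroup.mk AD), ← aux_mul_smul,
      ← aux_mul_smul, ← hAL1, ← hAL1]
    simp only [QuotientGroup.mk_mul, mul_assoc, mul_inv_cancel_left, mul_inv_cancel, aux_one_smul]
  have hR0 : 0 < R := by linarith
  have hs : Real.sqrt R ^ 2 = R := Real.sq_sqrt hR0.le
  have hsi : (Real.sqrt R)⁻¹ ^ 2 = 1 / R := by rw [inv_pow, hs, one_div]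
  have hss : Real.sqrt R * (Real.sqrt R)⁻¹ = 1 := mul_inv_cancel₀ (Real.sqrt_pos.2 hR0).ne'
  have hDAD : ((AD * (A * AD) : SL2) : Matrix (Fin 2) (Fin 2) ℝ) = !![a * R, b; c, d / R] := by
    simp only [Matrix.SpecialLinearGroup.coe_mul, hAD, hA]
    ext i j
    fin_cases i <;> fin_cases j <;> simp [Matrix.mul_apply, Fin.sum_univ_two]
    · linear_combination a * hs
    · linear_combination b * hss
    · linear_combination c * hss
    · rw [div_eq_mul_one_div, ← hsi]; ring
  let F : ℝ × ℝ → ℝ := fun x =>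
    let C := (1 + x.1) / 2
    let S := ε * (1 - x.1) / 2
    let C' := (1 + x.2) / 2
    let S' := ε' * (1 - x.2) / 2
    (C * (a * R * C' + b * S') + S * (c * C' + d / R * S')) ^ 2 +
    (C * (a * R * S' + b * C') + S * (c * S' + d / R * C')) ^ 2 +
    (S * (a * R * C' + b * S') + C * (c * C' + d / R * S')) ^ 2 +
    (S * (a * R * S' + b * C') + C * (c * S' + d / R * C')) ^ 2
  have hFc : Continuous F := by
    simp only [F]; fun_prop
  have hF0 : F (0, 0) = (a * R + ε' * b + ε * c + ε * ε' * d / R) ^ 2 / 4 := by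
    simp only [F]
    rcases hε with rfl | rfl <;> rcases hε' with rfl | rfl <;> ring
  have hexp : Tendsto (fun s : ℝ => Real.exp (-s)) atTop (𝓝 0) :=
    Real.tendsto_exp_neg_atTop_nhds_zero
  have hlim : Tendsto (fun st : ℝ × ℝ => F (Real.exp (-st.1), Real.exp (-st.2)))
      (atTop ×ˢ atTop) (𝓝 (F (0, 0))) :=
    (hFc.tendsto _).comp
      ((hexp.comp tendsto_fst).prodMk_nhds (hexp.comp tendsto_snd))
  rw [hF0] at hlim
  refine hlim.congr fun st => ?_
  rw [hd, aux_cosh]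
  obtain ⟨hc1, hs1⟩ := aux_cs ε hε st.1
  obtain ⟨hc2, hs2⟩ := aux_cs ε' hε' st.2
  have hM : ((AL (ε * st.1) * (AD * (A * (AD * AL (ε' * st.2)))) : SL2) :
      Matrix (Fin 2) (Fin 2) ℝ) = (AL (ε * st.1) : Matrix (Fin 2) (Fin 2) ℝ) *
        (!![a * R, b; c, d / R] * (AL (ε' * st.2) : Matrix (Fin 2) (Fin 2) ℝ)) := by
    rw [← hDAD]
    simp only [Matrix.SpecialLinearGroup.coe_mul, Matrix.mul_assoc]
  have hE : Real.exp (st.1 / 2) ^ 2 * Real.exp (st.2 / 2) ^ 2 * Real.exp (-(st.1 + st.2)) = 1 := by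
    rw [← Real.exp_nat_mul, ← Real.exp_nat_mul, ← Real.exp_add, ← Real.exp_add, Real.exp_eq_one_iff]
    push_cast; ring
  rw [hM, hAL2, hAL2, hc1, hs1, hc2, hs2]
  simp only [Matrix.mul_apply, Fin.sum_univ_two, Matrix.of_apply, Matrix.cons_val', Matrix.cons_val_zero,
    Matrix.cons_val_one, Matrix.cons_val_fin_one]
  refine (mul_one _).symm.trans ((congrArg _ hE.symm).trans ?_)
  simp only [F]
  ring

theorem stmt14 (R : ℝ) (hR : 1 < R) (ε ε' : ℝ)
    (hε : ε = 1 ∨ ε = -1) (hε' : ε' = 1 ∨ ε' = -1)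
    (D : PSL2)
    (hD : ∃ A : SL2, (QuotientGroup.mk A : PSL2) = D ∧
      (A : Matrix (Fin 2) (Fin 2) ℝ) = !![Real.sqrt R, 0; 0, (Real.sqrt R)⁻¹])
    (L : ℝ → PSL2)
    (hL : ∀ t : ℝ, ∃ A : SL2, (QuotientGroup.mk A : PSL2) = L t ∧
      (A : Matrix (Fin 2) (Fin 2) ℝ) =
        !![Real.cosh (t / 2), Real.sinh (t / 2); Real.sinh (t / 2), Real.cosh (t / 2)])
    (p p' : ℝ → ℍ)
    (hp : ∀ t, p t = pslSMul (D⁻¹ * (L t)⁻¹) UpperHalfPlane.I)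
    (hp' : ∀ t, p' t = pslSMul (D * L t) UpperHalfPlane.I)
    (g g' : PSL2) (a b c d : ℝ)
    (hlift : ∃ A : SL2, (QuotientGroup.mk A : PSL2) = g⁻¹ * g' ∧
      (A : Matrix (Fin 2) (Fin 2) ℝ) = !![a, b; c, d])
    (hne : a * R + ε' * b + ε * c + ε * ε' * d / R ≠ 0) :
    Tendsto
      (fun st : ℝ × ℝ =>
        dist (pslSMul g (p (ε * st.1))) (pslSMul g' (p' (ε' * st.2))) -
          dist (p (ε * st.1)) (p' (ε' * st.2)))
      (atTop ×ˢ atTop)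
      (𝓝 (Real.log ((a * R + ε' * b + ε * c + ε * ε' * d / R) ^ 2 / (R + ε * ε' / R) ^ 2))) := by
  have hR0 : 0 < R := by linarith
  have hY : R + ε * ε' / R ≠ 0 := by
    have h1 : 1 / R < 1 := by rw [div_lt_one hR0]; exact hR
    rcases hε with rfl | rfl <;> rcases hε' with rfl | rfl <;> norm_num <;>
      rw [one_div] at h1 <;> have h2 := inv_pos.2 hR0 <;> (try rw [neg_div, one_div]) <;>
      intro hh <;> linarith
  have k1 := aux_key R hR ε ε' hε hε' D hD L hL (g⁻¹ * g') a b c d hlift hne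
  have k2 := aux_key R hR ε ε' hε hε' D hD L hL 1 1 0 0 1
    ⟨1, rfl, by rw [Matrix.SpecialLinearGroup.coe_one, Matrix.one_fin_two]⟩ (by simpa using hY)
  have k := k1.sub k2
  have e : Real.log ((a * R + ε' * b + ε * c + ε * ε' * d / R) ^ 2 / 4) -
      Real.log ((1 * R + ε' * 0 + ε * 0 + ε * ε' * 1 / R) ^ 2 / 4) =
      Real.log ((a * R + ε' * b + ε * c + ε * ε' * d / R) ^ 2 / (R + ε * ε' / R) ^ 2) := by
    have e1 : 1 * R + ε' * 0 + ε * 0 + ε * ε' * 1 / R = R + ε * ε' / R := by ring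
    rw [e1, ← Real.log_div (by positivity) (by positivity)]
    congr 1
    exact div_div_div_cancel_right₀ (by norm_num) _ _
  rw [e] at k
  refine k.congr fun st => ?_
  rw [aux_dist' g g', hp, hp', aux_one_smul]
  ring

end
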